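/- Let 0<s<1 and 1<p<∞ satisfy 0<sp<n, and let G ⊊ ℝⁿ be an open set. Assume that there exist λ with n−sp<λ≤n and constants C₀>0, c≥1 such that H^λ_∞(∂^vis_{x,c}G) ≥ C₀ · dist(x,∂G)^λ for all x ∈ G. Then G admits the (s,p)-Hardy inequality. -/

import Mathlib

open MeasureTheory Metric Set
open scoped ENNReal NNReal Topology

noncomputable section

/-- Euclidean space `ℝⁿ`. -/
abbrev Euc (n : ℕ) := EuclideanSpace ℝ (Fin n)

/-- The `λ`-Hausdorff content of a set `E ⊆ ℝⁿ`:
`H^λ_∞(E) = inf { Σ_i r_i^λ : E ⊆ ⋃_i B(x_i, r_i), r_i > 0 }`. -/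
def hContent (n : ℕ) (lam : ℝ) (E : Set (Euc n)) : ℝ≥0∞ :=
  ⨅ (c : ℕ → Euc n × ℝ) (_ : ∀ i, 0 < (c i).2)
    (_ : E ⊆ ⋃ i, Metric.ball (c i).1 (c i).2),
    ∑' i, ENNReal.ofReal ((c i).2 ^ lam)

/-- The Riesz `(s,p)`-capacity of a set `E ⊆ ℝⁿ`:
`R_{s,p}(E) = inf { ‖f‖_p^p : f ≥ 0, I_s f ≥ 1 on E }`, where
`I_s f (x) = ∫ f(y) |x-y|^{s-n} dy`. -/
def rieszCap (n : ℕ) (s p : ℝ) (E : Set (Euc n)) : ℝ≥0∞ :=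
  ⨅ (f : Euc n → ℝ) (_ : Measurable f) (_ : ∀ x, 0 ≤ f x)
    (_ : ∀ x ∈ E, 1 ≤ ∫⁻ y, ENNReal.ofReal (f y) * ENNReal.ofReal (dist x y ^ (s - (n : ℝ)))),
    ∫⁻ x, ENNReal.ofReal (f x ^ p)

/-- A set `E ⊆ ℝⁿ` is `(s,p)`-uniformly fat:
`R_{s,p}(B(x,r) ∩ E) ≥ σ r^{n-sp}` for all `x ∈ E`, `r > 0`. -/
def UniformlyFat (n : ℕ) (s p : ℝ) (E : Set (Euc n)) : Prop :=
  ∃ σ : ℝ, 0 < σ ∧ ∀ x ∈ E, ∀ r : ℝ, 0 < r →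
    ENNReal.ofReal (σ * r ^ ((n : ℝ) - s * p)) ≤ rieszCap n s p (Metric.ball x r ∩ E)

/-- A set `E ⊆ ℝⁿ` is locally `(s,p)`-uniformly fat:
`R_{s,p}(B(x,r) ∩ E) ≥ σ r^{n-sp}` for all `x ∈ E`, `0 < r < r₀`. -/
def LocallyUniformlyFat (n : ℕ) (s p : ℝ) (E : Set (Euc n)) : Prop :=
  ∃ σ r₀ : ℝ, 0 < σ ∧ 0 < r₀ ∧ ∀ x ∈ E, ∀ r : ℝ, 0 < r → r < r₀ →
    ENNReal.ofReal (σ * r ^ ((n : ℝ) - s * p)) ≤ rieszCap n s p (Metric.ball x r ∩ E)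

/-- An open set `G ⊆ ℝⁿ` admits the `(s,p)`-Hardy inequality:
`∫_G |u|^p dist(x,∂G)^{-sp} dx ≤ c ∫_G ∫_G |u(x)-u(y)|^p |x-y|^{-(n+sp)} dy dx`
for every `u ∈ C_c^∞(G)`. -/
def AdmitsHardy (n : ℕ) (s p : ℝ) (G : Set (Euc n)) : Prop :=
  ∃ c : ℝ, 0 < c ∧ ∀ u : Euc n → ℝ,
    ContDiff ℝ (⊤ : ℕ∞) u → HasCompactSupport u → tsupport u ⊆ G →
    (∫⁻ x in G, ENNReal.ofReal (|u x| ^ p / Metric.infDist x (frontier G) ^ (s * p))) ≤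
      ENNReal.ofReal c *
        ∫⁻ x in G, ∫⁻ y in G, ENNReal.ofReal (|u x - u y| ^ p / dist x y ^ ((n : ℝ) + s * p))

/-- `U` is a `c`-John domain with center point `x₀`: every `x ∈ U` is joined to `x₀`
by an arc-length-parameterized (here: 1-Lipschitz) curve `γ : [0,ℓ] → U` with
`dist(γ(t), ∂U) ≥ t/c`. -/
def IsJohnDomain (n : ℕ) (c : ℝ) (U : Set (Euc n)) (x₀ : Euc n) : Prop :=
  IsOpen U ∧ IsConnected U ∧ x₀ ∈ U ∧
  ∀ x ∈ U, ∃ ℓ : ℝ, 0 ≤ ℓ ∧ ∃ γ : ℝ → Euc n,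
    LipschitzOnWith 1 γ (Set.Icc 0 ℓ) ∧ γ 0 = x ∧ γ ℓ = x₀ ∧
    ∀ t ∈ Set.Icc 0 ℓ, γ t ∈ U ∧ t / c ≤ Metric.infDist (γ t) (frontier U)

/-- `G_{x,c}`: the union of all `c`-John subdomains of `G` with center point `x`. -/
def johnPart (n : ℕ) (c : ℝ) (G : Set (Euc n)) (x : Euc n) : Set (Euc n) :=
  ⋃₀ {U : Set (Euc n) | U ⊆ G ∧ IsJohnDomain n c U x}

/-- The `c`-visual boundary of `G` near `x`: `∂^vis_{x,c} G = ∂G ∩ ∂G_{x,c}`. -/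
def visualBoundary (n : ℕ) (c : ℝ) (G : Set (Euc n)) (x : Euc n) : Set (Euc n) :=
  frontier G ∩ frontier (johnPart n c G x)

/-- `G` is a uniform domain with constant `C`. -/
def IsUniformDomain (n : ℕ) (C : ℝ) (G : Set (Euc n)) : Prop :=
  IsOpen G ∧ IsConnected G ∧
  ∀ x ∈ G, ∀ y ∈ G, ∃ ℓ : ℝ, 0 ≤ ℓ ∧ ℓ ≤ C * dist x y ∧
    ∃ γ : ℝ → Euc n, LipschitzOnWith 1 γ (Set.Icc 0 ℓ) ∧ γ 0 = x ∧ γ ℓ = y ∧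
      ∀ t ∈ Set.Icc 0 ℓ, γ t ∈ G ∧
        min (dist (γ t) x) (dist (γ t) y) / C ≤ Metric.infDist (γ t) (frontier G)

/-- The closed axis-parallel cube with center `z` and side length `ℓ`. -/
def cube (n : ℕ) (z : Euc n) (ℓ : ℝ) : Set (Euc n) := {y | ∀ i, |y i - z i| ≤ ℓ / 2}

/-- Distance between two sets. -/
def setSetDist (n : ℕ) (A B : Set (Euc n)) : ℝ := sInf (Set.image2 dist A B)

/-- `Q = cube z ℓ` is a Whitney cube of the open set `G`:
`Q ⊆ G` and `diam Q ≤ dist(Q, ∂G) ≤ 4 diam Q`. -/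
def IsWhitneyCube (n : ℕ) (G : Set (Euc n)) (z : Euc n) (ℓ : ℝ) : Prop :=
  0 < ℓ ∧ cube n z ℓ ⊆ G ∧
    Metric.diam (cube n z ℓ) ≤ setSetDist n (cube n z ℓ) (frontier G) ∧
    setSetDist n (cube n z ℓ) (frontier G) ≤ 4 * Metric.diam (cube n z ℓ)

/-- The `p`-th power of the Gagliardo `(s,p)`-seminorm of `u` on `A`:
`|u|_{W^{s,p}(A)}^p = ∫_A ∫_A |u(x)-u(y)|^p |x-y|^{-(n+sp)} dy dx`. -/
def gagliardoP (n : ℕ) (s p : ℝ) (A : Set (Euc n)) (u : Euc n → ℝ) : ℝ≥0∞ :=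
  ∫⁻ x in A, ∫⁻ y in A, ENNReal.ofReal (|u x - u y| ^ p / dist x y ^ ((n : ℝ) + s * p))

/-- `E` is an Ahlfors `λ`-regular set: `E` is closed and
`C⁻¹ r^λ ≤ H^λ(B(x,r) ∩ E) ≤ C r^λ` for `x ∈ E`, `0 < r < diam E`. -/
def AhlforsRegular (n : ℕ) (lam : ℝ) (E : Set (Euc n)) : Prop :=
  IsClosed E ∧ ∃ C : ℝ, 1 < C ∧ ∀ x ∈ E, ∀ r : ℝ, 0 < r →
    ENNReal.ofReal r < EMetric.diam E →
      ENNReal.ofReal (C⁻¹ * r ^ lam) ≤ μH[lam] (Metric.ball x r ∩ E) ∧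
      μH[lam] (Metric.ball x r ∩ E) ≤ ENNReal.ofReal (C * r ^ lam)

theorem infDist_frontier_le_dist {n : ℕ} {U : Set (Euc n)} {a b : Euc n} (ha : a ∈ U)
    (hb : b ∉ U) : infDist a (frontier U) ≤ dist a b := by
  have hU : U ≠ univ := fun h => hb (h ▸ mem_univ b)
  obtain ⟨y, hy, hay⟩ := exists_mem_frontier_infDist_compl_eq_dist ha hU
  calc infDist a (frontier U) ≤ dist a y := infDist_le_dist_of_mem hy
    _ = infDist a Uᶜ := hay.symm
    _ ≤ dist a b := infDist_le_dist_of_mem hb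

theorem frontier_nonempty_of_mem {n : ℕ} {U : Set (Euc n)} {a : Euc n} (ha : a ∈ U)
    (hU : U ≠ univ) : (frontier U).Nonempty :=
  let ⟨y, hy, _⟩ := exists_mem_frontier_infDist_compl_eq_dist ha hU
  ⟨y, hy⟩

theorem infDist_frontier_pos {n : ℕ} {G : Set (Euc n)} (hG : IsOpen G) (hG' : G ≠ univ)
    {x : Euc n} (hx : x ∈ G) : 0 < infDist x (frontier G) := by
  refine (isClosed_frontier.notMem_iff_infDist_pos (frontier_nonempty_of_mem hx hG')).1 ?_
  rw [hG.frontier_eq]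
  exact fun h => h.2 hx

theorem infDist_frontier_mono {n : ℕ} {U G : Set (Euc n)} (hG : IsOpen G) (hG' : G ≠ univ)
    (hUG : U ⊆ G) {a : Euc n} (ha : a ∈ U) :
    infDist a (frontier U) ≤ infDist a (frontier G) := by
  refine (le_infDist (frontier_nonempty_of_mem (hUG ha) hG')).2 fun b hb => ?_
  refine infDist_frontier_le_dist ha fun hbU => ?_
  rw [hG.frontier_eq] at hb
  exact hb.2 (hUG hbU)

/-- Points of the visual boundary are approached by curves from `x` of length `c dist(x,∂G)`
satisfying the John condition with respect to `G`. -/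
theorem exists_john_curve {n : ℕ} {c : ℝ} (hc : 1 ≤ c) {G : Set (Euc n)} (hG : IsOpen G)
    (hG' : G ≠ univ) {x ω : Euc n} (hω : ω ∈ visualBoundary n c G x)
    {ρ : ℝ} (hρ : 0 < ρ) :
    ∃ γ : ℝ → Euc n, dist (γ 0) ω < ρ ∧ γ (c * infDist x (frontier G)) = x ∧
      (∀ t ∈ Icc 0 (c * infDist x (frontier G)), ∀ t' ∈ Icc 0 (c * infDist x (frontier G)),
        dist (γ t) (γ t') ≤ |t - t'|) ∧
      ∀ t ∈ Icc 0 (c * infDist x (frontier G)), γ t ∈ G ∧ t / c ≤ infDist (γ t) (frontier G) := by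
  have hc0 : 0 < c := by linarith
  obtain ⟨y, ⟨U, ⟨hUG, -, -, hxU, hJ⟩, hyU⟩, hyω⟩ :=
    Metric.mem_closure_iff.1 (frontier_subset_closure hω.2) ρ hρ
  obtain ⟨ℓ, hℓ, γ, hγ, hγ0, hγℓ, hγd⟩ := hJ y hyU
  set d := infDist x (frontier G)
  have hℓd : ℓ ≤ c * d := by
    have h1 := (hγd ℓ ⟨hℓ, le_rfl⟩).2
    rw [hγℓ] at h1
    have := (div_le_iff₀ hc0).1 (h1.trans (infDist_frontier_mono hG hG' hUG hxU))
    linarith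
  have hmem : ∀ t ∈ Icc 0 (c * d), min t ℓ ∈ Icc 0 ℓ := fun t ht =>
    ⟨le_min ht.1 hℓ, min_le_right _ _⟩
  refine ⟨fun t => γ (min t ℓ), ?_, ?_, ?_, ?_⟩
  · simp only [min_eq_left hℓ, hγ0]
    rwa [dist_comm]
  · simp only [min_eq_right hℓd, hγℓ]
  · intro t ht t' ht'
    have h := hγ.dist_le_mul _ (hmem t ht) _ (hmem t' ht')
    simp only [NNReal.coe_one, one_mul] at h
    refine h.trans ?_
    rw [Real.dist_eq]
    exact (abs_min_sub_min_le_max t ℓ t' ℓ).trans (by simp)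
  · intro t ht
    have h := hγd _ (hmem t ht)
    refine ⟨hUG h.1, ?_⟩
    rcases le_total t ℓ with htℓ | htℓ
    · simp only [min_eq_left htℓ] at h ⊢
      exact h.2.trans (infDist_frontier_mono hG hG' hUG h.1)
    · simp only [min_eq_right htℓ, hγℓ]
      rw [div_le_iff₀ hc0]
      linarith [ht.2]

theorem hContent_le_tsum {n : ℕ} {lam : ℝ} (hlam : 0 < lam) {ι : Type*} [Countable ι]
    {E : Set (Euc n)} (z : ι → Euc n) (r : ι → ℝ) (hr : ∀ i, 0 < r i)
    (hE : E ⊆ ⋃ i, ball (z i) (r i)) :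
    hContent n lam E ≤ ∑' i, ENNReal.ofReal (r i ^ lam) := by
  refine ENNReal.le_of_forall_pos_le_add fun η hη _ => ?_
  obtain ⟨η', hη'0, hη'⟩ := ENNReal.exists_pos_sum_of_countable
    (ENNReal.coe_ne_zero.2 hη.ne') ℕ
  have := Encodable.ofCountable ι
  let q : ℕ → Euc n × ℝ := fun k =>
    (Encodable.decode₂ ι k).elim (0, (η' k : ℝ) ^ (1 / lam)) fun i => (z i, r i)
  have hη'r (k : ℕ) : 0 < (η' k : ℝ) := NNReal.coe_pos.2 (hη'0 k)
  have hq : ∀ k, 0 < (q k).2 := fun k => by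
    simp only [q]
    cases Encodable.decode₂ ι k with
    | none => exact Real.rpow_pos_of_pos (hη'r k) _
    | some i => exact hr i
  have hcover : E ⊆ ⋃ k, ball (q k).1 (q k).2 := by
    intro y hy
    obtain ⟨i, hi⟩ := mem_iUnion.1 (hE hy)
    exact mem_iUnion.2 ⟨Encodable.encode i, by simpa [q, Encodable.decode₂_encode] using hi⟩
  have hsum : ∑' k, ENNReal.ofReal ((q k).2 ^ lam) ≤
      ∑' k, ((Encodable.decode₂ ι k).elim 0 fun i => ENNReal.ofReal (r i ^ lam)) +
        ∑' k, (η' k : ℝ≥0∞) := by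
    rw [← ENNReal.tsum_add]
    refine ENNReal.tsum_le_tsum fun k => ?_
    simp only [q]
    cases Encodable.decode₂ ι k with
    | none =>
      simp only [Option.elim_none, zero_add]
      rw [← Real.rpow_mul (hη'r k).le, one_div_mul_cancel hlam.ne', Real.rpow_one,
        ENNReal.ofReal_coe_nnreal]
    | some i => simp
  have hdec : ∑' k, ((Encodable.decode₂ ι k).elim 0 fun i => ENNReal.ofReal (r i ^ lam)) ≤
      ∑' i, ENNReal.ofReal (r i ^ lam) := by
    rw [← Function.Injective.tsum_eq (Encodable.encode_injective (α := ι))]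
    · simp [Encodable.decode₂_encode]
    · refine fun k hk => Encodable.decode₂_ne_none_iff.1 fun hnone => hk ?_
      simp [hnone]
  calc hContent n lam E ≤ ∑' k, ENNReal.ofReal ((q k).2 ^ lam) :=
        iInf_le_of_le q (iInf_le_of_le hq (iInf_le _ hcover))
    _ ≤ _ := hsum
    _ ≤ _ := add_le_add hdec hη'.le

theorem hContent_le_lintegral {n : ℕ} {lam K M R : ℝ} (hlam : 0 < lam) (hK : 1 ≤ K) (hM : 0 < M)
    {E S : Set (Euc n)} (h : Euc n → ℝ≥0∞)
    (hE : ∀ ω ∈ E, ∃ z r, 0 < r ∧ r ≤ R ∧ dist ω z ≤ K * r ∧ ball z r ⊆ S ∧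
      ENNReal.ofReal (M * r ^ lam) ≤ ∫⁻ y in ball z r, h y) :
    ENNReal.ofReal M * hContent n lam E ≤ ENNReal.ofReal ((5 * K) ^ lam) * ∫⁻ y in S, h y := by
  have hK0 : 0 < K := by linarith
  choose! z r hr0 hrR hωz hzS hint using hE
  obtain ⟨u, huE, hdisj, hcov⟩ := Vitali.exists_disjoint_subfamily_covering_enlargement_closedBall
    E z (fun ω => K * r ω) (K * R) (fun ω hω => by gcongr; exact hrR ω hω) 4 (by norm_num)
  have hsub : ∀ ω ∈ u, ball (z ω) (r ω) ⊆ closedBall (z ω) (K * r ω) := fun ω hω =>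
    ball_subset_closedBall.trans
      (closedBall_subset_closedBall (le_mul_of_one_le_left (hr0 ω (huE hω)).le hK))
  have hdisj' : u.PairwiseDisjoint fun ω => ball (z ω) (r ω) := hdisj.mono_on hsub
  have hcount : u.Countable := hdisj'.countable_of_isOpen (fun _ _ => isOpen_ball)
    fun ω hω => nonempty_ball.2 (hr0 ω (huE hω))
  have := hcount.to_subtype
  have h1 : hContent n lam E ≤ ∑' ω : u, ENNReal.ofReal ((5 * K * r ω) ^ lam) := by
    refine hContent_le_tsum hlam (fun ω : u => z ω) (fun ω : u => 5 * K * r ω)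
      (fun ω => by have := hr0 ω (huE ω.2); positivity) fun ω hω => ?_
    obtain ⟨b, hb, hsubb⟩ := hcov ω hω
    refine mem_iUnion.2 ⟨⟨b, hb⟩, ?_⟩
    have h2 : dist ω (z b) ≤ 4 * (K * r b) := hsubb (mem_closedBall.2 (hωz ω hω))
    have h3 : 0 < K * r b := mul_pos hK0 (hr0 b (huE hb))
    exact mem_ball.2 (by linarith)
  calc ENNReal.ofReal M * hContent n lam E
      ≤ ENNReal.ofReal M * ∑' ω : u, ENNReal.ofReal ((5 * K * r ω) ^ lam) := by gcongr
    _ = ∑' ω : u, ENNReal.ofReal ((5 * K) ^ lam) * ENNReal.ofReal (M * r ω ^ lam) := by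
      rw [← ENNReal.tsum_mul_left]
      refine tsum_congr fun ω => ?_
      rw [← ENNReal.ofReal_mul hM.le, ← ENNReal.ofReal_mul (by positivity),
        Real.mul_rpow (by positivity) (hr0 ω (huE ω.2)).le]
      ring_nf
    _ = ENNReal.ofReal ((5 * K) ^ lam) * ∑' ω : u, ENNReal.ofReal (M * r ω ^ lam) :=
      ENNReal.tsum_mul_left
    _ ≤ ENNReal.ofReal ((5 * K) ^ lam) * ∑' ω : u, ∫⁻ y in ball (z ω) (r ω), h y := by
      gcongr with ω
      exact hint ω (huE ω.2)
    _ = ENNReal.ofReal ((5 * K) ^ lam) * ∫⁻ y in ⋃ ω ∈ u, ball (z ω) (r ω), h y := by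
      rw [lintegral_biUnion hcount (fun _ _ => measurableSet_ball) hdisj']
    _ ≤ ENNReal.ofReal ((5 * K) ^ lam) * ∫⁻ y in S, h y := by
      gcongr
      exact iUnion₂_subset fun ω hω => hzS ω (huE hω)

theorem ofReal_abs_sub_average_rpow_mul_le {n : ℕ} {p : ℝ} (hp : 1 ≤ p) {u : Euc n → ℝ}
    (hu : Continuous u) (v : ℝ) (y : Euc n) {r : ℝ} (hr : 0 < r) :
    ENNReal.ofReal (|v - ⨍ w in ball y r, u w| ^ p) * volume (ball y r) ≤
      ∫⁻ w in ball y r, ENNReal.ofReal (|v - u w| ^ p) := by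
  have hp0 : 0 ≤ p := by linarith
  have hint : ∀ f : Euc n → ℝ, Continuous f → IntegrableOn f (ball y r) := fun f hf =>
    (hf.continuousOn.integrableOn_compact (isCompact_closedBall y r)).mono_set
      ball_subset_closedBall
  have hpos : volume (ball y r) ≠ 0 := (measure_ball_pos volume y hr).ne'
  have hfin : volume (ball y r) ≠ ∞ := measure_ball_lt_top.ne
  have hcont : Continuous fun w => |v - u w| := by fun_prop
  have hcontp : Continuous fun w => |v - u w| ^ p := hcont.rpow_const fun _ => Or.inr hp0
  have hposr : 0 < volume.real (ball y r) := ENNReal.toReal_pos hpos hfin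
  have hlin : v - ⨍ w in ball y r, u w = ⨍ w in ball y r, (v - u w) := by
    rw [setAverage_eq, setAverage_eq, integral_sub (hint _ continuous_const) (hint u hu),
      setIntegral_const, smul_sub, smul_smul, inv_mul_cancel₀ hposr.ne', one_smul]
  have habs : |v - ⨍ w in ball y r, u w| ≤ ⨍ w in ball y r, |v - u w| := by
    rw [hlin, setAverage_eq, setAverage_eq, smul_eq_mul, smul_eq_mul, abs_mul,
      abs_of_pos (inv_pos.2 hposr)]
    gcongr
    exact abs_integral_le_integral_abs
  have hjensen : (⨍ w in ball y r, |v - u w|) ^ p ≤ ⨍ w in ball y r, |v - u w| ^ p :=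
    (convexOn_rpow hp).map_set_average_le (Real.continuous_rpow_const hp0).continuousOn isClosed_Ici
      hpos hfin (by simp) (hint _ hcont) (hint _ hcontp)
  rw [← ofReal_integral_eq_lintegral_ofReal (hint _ hcontp)
    (Filter.Eventually.of_forall fun w => by positivity), ← ofReal_measureReal hfin,
    ← ENNReal.ofReal_mul (by positivity)]
  refine ENNReal.ofReal_le_ofReal ?_
  calc |v - ⨍ w in ball y r, u w| ^ p * volume.real (ball y r)
      ≤ (⨍ w in ball y r, |v - u w| ^ p) * volume.real (ball y r) := by
        gcongr
        exact (Real.rpow_le_rpow (abs_nonneg _) habs hp0).trans hjensen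
    _ = ∫ w in ball y r, |v - u w| ^ p := by
        rw [setAverage_eq, smul_eq_mul]
        field_simp

/-- The inner integral of the Gagliardo seminorm on `G`. -/
def gagliardoDensity (n : ℕ) (s p : ℝ) (G : Set (Euc n)) (u : Euc n → ℝ) (z : Euc n) : ℝ≥0∞ :=
  ∫⁻ w in G, ENNReal.ofReal (|u z - u w| ^ p / dist z w ^ ((n : ℝ) + s * p))

theorem measurable_gagliardoDensity {n : ℕ} {s p : ℝ} {G : Set (Euc n)} {u : Euc n → ℝ}
    (hu : Continuous u) : Measurable (gagliardoDensity n s p G u) := by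
  have := hu.measurable
  refine Measurable.lintegral_prod_right' (f := fun q : Euc n × Euc n =>
    ENNReal.ofReal (|u q.1 - u q.2| ^ p / dist q.1 q.2 ^ ((n : ℝ) + s * p))) ?_
  have h1 : Measurable fun q : Euc n × Euc n => |u q.1 - u q.2| :=
    (continuous_abs.measurable).comp (by fun_prop)
  exact ((h1.pow_const p).div (measurable_dist.pow_const _)).ennreal_ofReal

theorem ofReal_abs_sub_average_rpow_mul_le_gagliardoDensity {n : ℕ} {s p : ℝ} (hs : 0 < s)
    (hp : 1 ≤ p) {G : Set (Euc n)} {u : Euc n → ℝ} (hu : Continuous u) {y z : Euc n} {r R : ℝ}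
    (hr : 0 < r) (hG : ball y r ⊆ G) (hR : ∀ w ∈ ball y r, dist z w ≤ R) :
    ENNReal.ofReal (|u z - ⨍ w in ball y r, u w| ^ p) * volume (ball y r) ≤
      ENNReal.ofReal (R ^ ((n : ℝ) + s * p)) * gagliardoDensity n s p G u z := by
  refine (ofReal_abs_sub_average_rpow_mul_le hp hu (u z) y hr).trans ?_
  have hα : 0 < (n : ℝ) + s * p := by positivity
  calc ∫⁻ w in ball y r, ENNReal.ofReal (|u z - u w| ^ p)
      ≤ ∫⁻ w in ball y r, ENNReal.ofReal (R ^ ((n : ℝ) + s * p)) *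
          ENNReal.ofReal (|u z - u w| ^ p / dist z w ^ ((n : ℝ) + s * p)) := by
        refine setLIntegral_mono_ae' measurableSet_ball (Filter.Eventually.of_forall fun w hw => ?_)
        have hRw := hR w hw
        have hR0 : 0 ≤ R := dist_nonneg.trans hRw
        rw [← ENNReal.ofReal_mul (by positivity)]
        refine ENNReal.ofReal_le_ofReal ?_
        rcases eq_or_ne z w with rfl | hzw
        · rw [sub_self, abs_zero, Real.zero_rpow (by linarith)]
          simp
        · have hd : 0 < dist z w ^ ((n : ℝ) + s * p) := Real.rpow_pos_of_pos (dist_pos.2 hzw) _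
          rw [mul_div_assoc', le_div_iff₀ hd, mul_comm]
          gcongr
    _ = ENNReal.ofReal (R ^ ((n : ℝ) + s * p)) * ∫⁻ w in ball y r,
          ENNReal.ofReal (|u z - u w| ^ p / dist z w ^ ((n : ℝ) + s * p)) :=
        lintegral_const_mul' _ _ ENNReal.ofReal_ne_top
    _ ≤ _ := by
        gcongr
        exact lintegral_mono_set hG

theorem ofReal_abs_average_sub_average_rpow_mul_le {n : ℕ} {s p : ℝ} (hs : 0 < s)
    (hp : 1 ≤ p) {G : Set (Euc n)} {u : Euc n → ℝ} (hu : Continuous u) {y y' : Euc n}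
    {r r' R : ℝ} (hr : 0 < r) (hr' : 0 < r') (hG : ball y' r' ⊆ G)
    (hR : ∀ z ∈ ball y r, ∀ w ∈ ball y' r', dist z w ≤ R) :
    ENNReal.ofReal (|(⨍ w in ball y r, u w) - ⨍ w in ball y' r', u w| ^ p) *
        volume (ball y r) * volume (ball y' r') ≤
      ENNReal.ofReal (R ^ ((n : ℝ) + s * p)) *
        ∫⁻ z in ball y r, gagliardoDensity n s p G u z := by
  rw [abs_sub_comm]
  calc _ ≤ (∫⁻ z in ball y r, ENNReal.ofReal (|(⨍ w in ball y' r', u w) - u z| ^ p)) *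
        volume (ball y' r') := by
        gcongr
        exact ofReal_abs_sub_average_rpow_mul_le hp hu _ y hr
    _ = ∫⁻ z in ball y r, ENNReal.ofReal (|u z - ⨍ w in ball y' r', u w| ^ p) *
        volume (ball y' r') := by
        rw [lintegral_mul_const' _ _ measure_ball_lt_top.ne]
        simp_rw [abs_sub_comm]
    _ ≤ ∫⁻ z in ball y r, ENNReal.ofReal (R ^ ((n : ℝ) + s * p)) *
          gagliardoDensity n s p G u z :=
        setLIntegral_mono_ae' measurableSet_ball (Filter.Eventually.of_forall fun z hz =>
          ofReal_abs_sub_average_rpow_mul_le_gagliardoDensity hs hp hu hr' hG (hR z hz))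
    _ = _ := lintegral_const_mul' _ _ ENNReal.ofReal_ne_top

theorem exists_large_increment {a : ℕ → ℝ} {q : ℝ} (hq0 : 0 < q) {N : ℕ}
    (ha0 : a 0 ≠ 0) (haN : a N = 0) :
    ∃ i < N, (1 - q) * q ^ i * |a 0| ≤ |a i - a (i + 1)| := by
  by_contra! h
  have hA : 0 < |a 0| := abs_pos.2 ha0
  have hN : ∀ k ≤ N, |a 0 - a k| ≤ (1 - q ^ k) * |a 0| := by
    intro k
    induction k with
    | zero => simp
    | succ k ih =>
      intro hk
      have h1 := ih (by omega)
      have h2 := h k (by omega)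
      have h3 := abs_sub_le (a 0) (a k) (a (k + 1))
      calc _ ≤ _ := h3
        _ ≤ (1 - q ^ k) * |a 0| + (1 - q) * q ^ k * |a 0| := by linarith
        _ = _ := by ring
  have h1 := hN N le_rfl
  rw [haN, sub_zero] at h1
  have : 0 < q ^ N * |a 0| := by positivity
  linarith

theorem volume_ball_eq {n : ℕ} (x : Euc n) {r : ℝ} (hr : 0 < r) :
    volume (ball x r) = ENNReal.ofReal (r ^ n * volume.real (ball (0 : Euc n) 1)) := by
  rw [Measure.addHaar_ball_of_pos _ _ hr, ENNReal.ofReal_mul (by positivity),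
    ofReal_measureReal measure_ball_lt_top.ne, finrank_euclideanSpace_fin]

theorem volume_real_unit_ball_pos (n : ℕ) : 0 < volume.real (ball (0 : Euc n) 1) :=
  ENNReal.toReal_pos (measure_ball_pos volume _ one_pos).ne' measure_ball_lt_top.ne

theorem chain_constant_identity {n : ℕ} {s p ε A V r d θ k Q : ℝ} (hA : 0 ≤ A) (hr : 0 < r)
    (hd : 0 < d) (hk : 0 ≤ k) (hQ : 0 ≤ Q) (hQp : Q ^ p = (4 * r / d) ^ ε) :
    k ^ p * 4 ^ ε * V ^ 2 * θ ^ n * 3 ^ ε / 3 ^ ((n : ℝ) + s * p) * A ^ p * d ^ (-ε) *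
        r ^ ((n : ℝ) - s * p + 2 * ε) * (3 * r) ^ ((n : ℝ) + s * p) =
      (3 * r) ^ ε * ((k * Q * A) ^ p * (r ^ n * V) * ((θ * r) ^ n * V)) := by
  have hr' : r ^ ((n : ℝ) - s * p + 2 * ε) * r ^ ((n : ℝ) + s * p) =
      r ^ ε * r ^ ε * r ^ n * r ^ n := by
    rw [← Real.rpow_natCast, ← Real.rpow_add hr, ← Real.rpow_add hr, ← Real.rpow_add hr,
      ← Real.rpow_add hr]
    ring_nf
  have h3 : (0 : ℝ) < 3 ^ ((n : ℝ) + s * p) := by positivity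
  rw [Real.mul_rpow (by positivity) hA, Real.mul_rpow hk hQ, hQp,
    Real.div_rpow (by positivity) hd.le, Real.mul_rpow (by norm_num) hr.le,
    Real.mul_rpow (by norm_num) hr.le, Real.mul_rpow (by norm_num) hr.le, Real.rpow_neg hd.le,
    mul_pow]
  calc _ = k ^ p * 4 ^ ε * V ^ 2 * θ ^ n * 3 ^ ε * A ^ p * (d ^ ε)⁻¹ *
        (r ^ ((n : ℝ) - s * p + 2 * ε) * r ^ ((n : ℝ) + s * p)) := by
        field_simp
    _ = _ := by rw [hr']; ring

/-- Chaining along a John curve to a visible boundary point `ω`: one of the balls in the chain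
carries a large amount of weighted energy. -/
theorem exists_ball_large_energy {n : ℕ} {s p c ε : ℝ} (hs : 0 < s) (hp : 1 < p) (hc : 1 ≤ c)
    (hε : 0 < ε) {G : Set (Euc n)} (hG : IsOpen G) (hG' : G ≠ univ) :
    ∃ c₁ : ℝ, 0 < c₁ ∧ ∀ u : Euc n → ℝ, Continuous u → tsupport u ⊆ G →
      ∀ x ∈ G, (⨍ w in ball x (infDist x (frontier G) / 4), u w) ≠ 0 →
      ∀ ω ∈ visualBoundary n c G x, ∃ z r, 0 < r ∧ r ≤ infDist x (frontier G) ∧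
        dist ω z ≤ (4 * c + 1) * r ∧ dist z x ≤ c * infDist x (frontier G) ∧ ball z r ⊆ G ∧
        ENNReal.ofReal (c₁ * |⨍ w in ball x (infDist x (frontier G) / 4), u w| ^ p *
          infDist x (frontier G) ^ (-ε) * r ^ ((n : ℝ) - s * p + 2 * ε)) ≤
          ∫⁻ y in ball z r, ENNReal.ofReal (infDist y (frontier G) ^ ε) *
            gagliardoDensity n s p G u y := by
  have hc0 : 0 < c := by linarith
  have hp0 : 0 < p := by linarith
  obtain ⟨θ, hθ⟩ : ∃ θ, θ = 1 - 1 / (4 * c) := ⟨_, rfl⟩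
  have hθ1 : θ < 1 := by
    rw [hθ, sub_lt_self_iff]
    positivity
  have hθ0 : 0 < θ := by
    rw [hθ, sub_pos, div_lt_one (by positivity)]
    linarith
  have hθc : 4 * c * (1 - θ) = 1 := by rw [hθ]; field_simp; ring
  obtain ⟨q, hq⟩ : ∃ q, q = θ ^ (ε / p) := ⟨_, rfl⟩
  have hq0 : 0 < q := hq ▸ Real.rpow_pos_of_pos hθ0 _
  have hq1 : q < 1 := hq ▸ Real.rpow_lt_one hθ0.le hθ1 (by positivity)
  have hV := volume_real_unit_ball_pos n
  refine ⟨(1 - q) ^ p * 4 ^ ε * volume.real (ball (0 : Euc n) 1) ^ 2 * θ ^ n * 3 ^ ε /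
    3 ^ ((n : ℝ) + s * p), ?_, ?_⟩
  · have : 0 < 1 - q := by linarith
    positivity
  intro u hu hsupp x hx ha ω hω
  obtain ⟨d, hd⟩ : ∃ d, d = infDist x (frontier G) := ⟨_, rfl⟩
  have hd0 : 0 < d := hd ▸ infDist_frontier_pos hG hG' hx
  rw [← hd] at ha ⊢
  obtain ⟨r, hr⟩ : ∃ r : ℕ → ℝ, r = fun i => d / 4 * θ ^ i := ⟨_, rfl⟩
  have hr0 (i) : 0 < r i := by rw [hr]; positivity
  have hrsucc (i) : r (i + 1) = θ * r i := by simp only [hr, pow_succ]; ring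
  have hranti (i) (N) (h : i ≤ N) : r N ≤ r i := by
    simp only [hr]
    gcongr ?_ * ?_
    exact pow_le_pow_of_le_one hθ0.le hθ1.le h
  have hrd (i) : r i ≤ d / 4 := by
    refine (hranti 0 i (Nat.zero_le _)).trans ?_
    simp [hr]
  have hωG : ω ∉ tsupport u := fun h => by
    have := hω.1
    rw [hG.frontier_eq] at this
    exact this.2 (hsupp h)
  obtain ⟨η, hη, hηu⟩ := Metric.isOpen_iff.1 (isClosed_tsupport u).isOpen_compl ω hωG
  obtain ⟨N, hN⟩ : ∃ N, (4 * c + 2) * r N < η := by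
    obtain ⟨N, hN⟩ := exists_pow_lt_of_lt_one (show 0 < η / ((4 * c + 2) * (d / 4)) by positivity)
      hθ1
    refine ⟨N, ?_⟩
    rw [lt_div_iff₀ (by positivity)] at hN
    simp only [hr]
    linarith
  obtain ⟨γ, hγ0, hγx, hγlip, hγG⟩ := exists_john_curve hc hG hG' hω (hr0 N)
  rw [← hd] at hγx hγlip hγG
  have htmem (i) : 4 * c * r i ∈ Icc 0 (c * d) := by
    have h1 := hr0 i
    have h2 := mul_le_mul_of_nonneg_left (hrd i) (show 0 ≤ 4 * c by positivity)
    exact ⟨by positivity, by linarith⟩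
  obtain ⟨ζ, hζ⟩ : ∃ ζ : ℕ → Euc n, ζ = fun i => γ (4 * c * r i) := ⟨_, rfl⟩
  have hζG (i) : ζ i ∈ G ∧ 4 * r i ≤ infDist (ζ i) (frontier G) := by
    have h := hγG _ (htmem i)
    rw [hζ]
    refine ⟨h.1, ?_⟩
    calc 4 * r i = 4 * c * r i / c := by field_simp
      _ ≤ _ := h.2
  have hζω (i) (hi : i ≤ N) : dist ω (ζ i) ≤ (4 * c + 1) * r i := by
    have h1 := hγlip _ (htmem i) 0 ⟨le_rfl, by positivity⟩
    rw [sub_zero, abs_of_nonneg (htmem i).1] at h1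
    have h2 := dist_triangle_right ω (ζ i) (γ 0)
    have h3 := hranti i N hi
    rw [dist_comm] at hγ0
    rw [hζ] at h2 ⊢
    linarith
  have hballG (i) : ball (ζ i) (r i) ⊆ G := by
    intro w hw
    by_contra hwG
    have h1 := infDist_frontier_le_dist (hζG i).1 hwG
    rw [mem_ball, dist_comm] at hw
    linarith [(hζG i).2, hr0 i]
  have hζ0 : ζ 0 = x := by
    rw [hζ, ← hγx]
    simp only [hr, pow_zero]
    ring_nf
  obtain ⟨a, hadef⟩ : ∃ a : ℕ → ℝ, a = fun i => ⨍ w in ball (ζ i) (r i), u w := ⟨_, rfl⟩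
  have ha0 : a 0 = ⨍ w in ball x (d / 4), u w := by
    simp only [hadef, hζ0, hr, pow_zero, mul_one]
  have haN : a N = 0 := by
    simp only [hadef]
    rw [setAverage_eq, setIntegral_eq_zero_of_forall_eq_zero, smul_zero]
    intro w hw
    refine image_eq_zero_of_notMem_tsupport (hηu ?_)
    rw [mem_ball] at hw ⊢
    have h1 := dist_triangle_right w ω (ζ N)
    have h2 := hζω N le_rfl
    linarith
  rw [← ha0] at ha ⊢
  obtain ⟨i, hiN, hi⟩ := exists_large_increment hq0 ha haN
  refine ⟨ζ i, r i, hr0 i, by linarith [hrd i], hζω i hiN.le, ?_, hballG i, ?_⟩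
  · have h1 := hγlip _ (htmem i) (c * d) ⟨by positivity, le_rfl⟩
    rw [hγx, abs_sub_comm, abs_of_nonneg (by linarith [(htmem i).2])] at h1
    rw [hζ]
    linarith [(htmem i).1]
  have hQp : (q ^ i) ^ p = (4 * r i / d) ^ ε := by
    have h1 : 4 * r i / d = θ ^ i := by simp only [hr]; field_simp
    rw [h1, hq, ← Real.rpow_natCast, ← Real.rpow_natCast, ← Real.rpow_mul hθ0.le,
      ← Real.rpow_mul hθ0.le, ← Real.rpow_mul hθ0.le]
    congr 1
    field_simp
  have hstep : dist (ζ i) (ζ (i + 1)) ≤ r i := by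
    have h1 := hγlip _ (htmem i) _ (htmem (i + 1))
    have h2 : 4 * c * r i - 4 * c * r (i + 1) = r i := by
      rw [hrsucc]
      linear_combination r i * hθc
    rw [h2, abs_of_pos (hr0 i)] at h1
    rw [hζ]
    exact h1
  have hR : ∀ z ∈ ball (ζ i) (r i), ∀ w ∈ ball (ζ (i + 1)) (r (i + 1)), dist z w ≤ 3 * r i := by
    intro z hz w hw
    rw [mem_ball] at hz hw
    have h1 := dist_triangle4_right z w (ζ i) (ζ (i + 1))
    linarith [hranti i (i + 1) (Nat.le_succ i)]
  have hmain := ofReal_abs_average_sub_average_rpow_mul_le (s := s) hs hp.le hu (hr0 i)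
    (hr0 (i + 1)) (hballG (i + 1)) hR
  have hri := hr0 i
  have hk : 0 ≤ 1 - q := by linarith
  rw [volume_ball_eq _ (hr0 i), volume_ball_eq _ (hr0 (i + 1)), hrsucc,
    ← ENNReal.ofReal_mul (by positivity), ← ENNReal.ofReal_mul (by positivity)] at hmain
  have hweight : ENNReal.ofReal ((3 * r i) ^ ε) *
      ∫⁻ z in ball (ζ i) (r i), gagliardoDensity n s p G u z ≤
      ∫⁻ y in ball (ζ i) (r i), ENNReal.ofReal (infDist y (frontier G) ^ ε) *
        gagliardoDensity n s p G u y := by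
    rw [← lintegral_const_mul' _ _ ENNReal.ofReal_ne_top]
    refine setLIntegral_mono_ae' measurableSet_ball (Filter.Eventually.of_forall fun y hy => ?_)
    have h1 := infDist_le_infDist_add_dist (s := frontier G) (x := ζ i) (y := y)
    rw [mem_ball, dist_comm] at hy
    have h2 : 3 * r i ≤ infDist y (frontier G) := by linarith [(hζG i).2]
    gcongr
  have h3r : 0 < (3 * r i) ^ ((n : ℝ) + s * p) := by positivity
  rw [← ENNReal.mul_le_mul_iff_left (ENNReal.ofReal_pos.2 h3r).ne' ENNReal.ofReal_ne_top]
  rw [← ENNReal.ofReal_mul' h3r.le,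
    chain_constant_identity (abs_nonneg _) hri hd0 hk (by positivity) hQp]
  calc _ ≤ ENNReal.ofReal ((3 * r i) ^ ε * (|a i - a (i + 1)| ^ p *
        (r i ^ n * volume.real (ball (0 : Euc n) 1)) *
        ((θ * r i) ^ n * volume.real (ball (0 : Euc n) 1)))) := by
        gcongr
    _ ≤ ENNReal.ofReal ((3 * r i) ^ ε) * (ENNReal.ofReal ((3 * r i) ^ ((n : ℝ) + s * p)) *
        ∫⁻ z in ball (ζ i) (r i), gagliardoDensity n s p G u z) := by
        rw [ENNReal.ofReal_mul (by positivity)]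
        gcongr
        simpa only [hadef, hrsucc] using hmain
    _ ≤ _ := by
        rw [mul_left_comm, mul_comm]
        gcongr

theorem ofReal_average_rpow_div_le {n : ℕ} {s p c ε C₀ : ℝ} (hs : 0 < s) (hp : 1 < p)
    (hc : 1 ≤ c) (hε : 0 < ε) (hlam : 0 < (n : ℝ) - s * p + 2 * ε) (hC₀ : 0 < C₀)
    {G : Set (Euc n)} (hG : IsOpen G) (hG' : G ≠ univ)
    (hvis : ∀ x ∈ G, ENNReal.ofReal (C₀ * infDist x (frontier G) ^ ((n : ℝ) - s * p + 2 * ε)) ≤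
      hContent n ((n : ℝ) - s * p + 2 * ε) (visualBoundary n c G x)) :
    ∃ C : ℝ, 0 < C ∧ ∀ u : Euc n → ℝ, Continuous u → tsupport u ⊆ G → ∀ x ∈ G,
      ENNReal.ofReal (|⨍ w in ball x (infDist x (frontier G) / 4), u w| ^ p /
        infDist x (frontier G) ^ (s * p)) ≤
      ENNReal.ofReal C * (ENNReal.ofReal (infDist x (frontier G) ^ (-((n : ℝ) + ε))) *
        ∫⁻ y in ball x ((c + 1) * infDist x (frontier G)) ∩ G,
          ENNReal.ofReal (infDist y (frontier G) ^ ε) * gagliardoDensity n s p G u y) := by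
  obtain ⟨c₁, hc₁, hball⟩ := exists_ball_large_energy (s := s) hs hp hc hε hG hG'
  have hK : 0 < (5 * (4 * c + 1)) ^ ((n : ℝ) - s * p + 2 * ε) :=
    Real.rpow_pos_of_pos (by linarith) _
  refine ⟨(5 * (4 * c + 1)) ^ ((n : ℝ) - s * p + 2 * ε) / (c₁ * C₀), by positivity, ?_⟩
  intro u hu hsupp x hx
  have hd0 := infDist_frontier_pos hG hG' hx
  have hball' := hball u hu hsupp x hx
  have hvis' := hvis x hx
  set d := infDist x (frontier G)
  set A := |⨍ w in ball x (d / 4), u w| with hA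
  rcases eq_or_ne (⨍ w in ball x (d / 4), u w) 0 with h0 | h0
  · rw [hA, h0, abs_zero, Real.zero_rpow (by linarith), zero_div, ENNReal.ofReal_zero]
    exact zero_le
  have hA0 : 0 < A := abs_pos.2 h0
  set I := ∫⁻ y in ball x ((c + 1) * d) ∩ G,
    ENNReal.ofReal (infDist y (frontier G) ^ ε) * gagliardoDensity n s p G u y
  have hcov : ENNReal.ofReal (c₁ * A ^ p * d ^ (-ε)) *
      hContent n ((n : ℝ) - s * p + 2 * ε) (visualBoundary n c G x) ≤
      ENNReal.ofReal ((5 * (4 * c + 1)) ^ ((n : ℝ) - s * p + 2 * ε)) * I := by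
    refine hContent_le_lintegral (R := d) hlam (by linarith) (by positivity) _ fun ω hω => ?_
    obtain ⟨z, r, hr0, hrd, hωz, hzx, hzG, hI⟩ := hball' h0 ω hω
    refine ⟨z, r, hr0, hrd, hωz, subset_inter (fun w hw => ?_) hzG, hI⟩
    rw [mem_ball] at hw ⊢
    have := dist_triangle w z x
    linarith
  have hid : A ^ p / d ^ (s * p) = (1 / (c₁ * C₀) * d ^ (-((n : ℝ) + ε))) *
      (c₁ * A ^ p * d ^ (-ε) * (C₀ * d ^ ((n : ℝ) - s * p + 2 * ε))) := by
    have h1 : (d ^ (s * p))⁻¹ =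
        d ^ (-((n : ℝ) + ε)) * d ^ (-ε) * d ^ ((n : ℝ) - s * p + 2 * ε) := by
      rw [← Real.rpow_add hd0, ← Real.rpow_add hd0, ← Real.rpow_neg hd0.le]
      ring_nf
    rw [div_eq_mul_inv, h1]
    field_simp
  calc ENNReal.ofReal (A ^ p / d ^ (s * p))
      = ENNReal.ofReal (1 / (c₁ * C₀) * d ^ (-((n : ℝ) + ε))) *
        (ENNReal.ofReal (c₁ * A ^ p * d ^ (-ε)) *
          ENNReal.ofReal (C₀ * d ^ ((n : ℝ) - s * p + 2 * ε))) := by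
        rw [hid, ENNReal.ofReal_mul (by positivity),
          ENNReal.ofReal_mul (p := c₁ * A ^ p * d ^ (-ε)) (by positivity)]
    _ ≤ ENNReal.ofReal (1 / (c₁ * C₀) * d ^ (-((n : ℝ) + ε))) *
        (ENNReal.ofReal ((5 * (4 * c + 1)) ^ ((n : ℝ) - s * p + 2 * ε)) * I) := by
        refine mul_le_mul' le_rfl (le_trans ?_ hcov)
        gcongr
    _ = _ := by
        rw [← mul_assoc, ← mul_assoc, ← ENNReal.ofReal_mul (by positivity),
          ← ENNReal.ofReal_mul (by positivity)]
        congr 2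
        ring

theorem exists_lintegral_add_dist_rpow_le (n : ℕ) {ε : ℝ} (hε : 0 < ε) :
    ∃ J : ℝ, 0 < J ∧ ∀ (z : Euc n) (D : ℝ), 0 < D →
      ∫⁻ x, ENNReal.ofReal ((D + dist z x) ^ (-((n : ℝ) + ε))) ≤
        ENNReal.ofReal (J * D ^ (-ε)) := by
  have hJ := finite_integral_one_add_norm (E := Euc n) (μ := volume) (r := (n : ℝ) + ε)
    (by rw [finrank_euclideanSpace_fin]; linarith)
  set J := ∫⁻ x : Euc n, ENNReal.ofReal ((1 + ‖x‖) ^ (-((n : ℝ) + ε)))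
  refine ⟨J.toReal + 1, by positivity, fun z D hD => ?_⟩
  have hfm : Measurable fun y : Euc n => ENNReal.ofReal ((1 + ‖y‖) ^ (-((n : ℝ) + ε))) := by
    fun_prop
  calc ∫⁻ x, ENNReal.ofReal ((D + dist z x) ^ (-((n : ℝ) + ε)))
      = ∫⁻ x : Euc n, ENNReal.ofReal ((D + ‖x‖) ^ (-((n : ℝ) + ε))) := by
        rw [← lintegral_sub_right_eq_self
          (fun x : Euc n => ENNReal.ofReal ((D + ‖x‖) ^ (-((n : ℝ) + ε)))) z]
        simp_rw [dist_eq_norm, norm_sub_rev z]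
    _ = ∫⁻ x : Euc n, ENNReal.ofReal (D ^ (-((n : ℝ) + ε))) *
          ENNReal.ofReal ((1 + ‖D⁻¹ • x‖) ^ (-((n : ℝ) + ε))) := by
        refine lintegral_congr fun x => ?_
        rw [← ENNReal.ofReal_mul (by positivity), ← Real.mul_rpow hD.le (by positivity), norm_smul,
          Real.norm_of_nonneg (inv_nonneg.2 hD.le), mul_add, mul_one, mul_inv_cancel_left₀ hD.ne']
    _ = ENNReal.ofReal (D ^ (-((n : ℝ) + ε))) * (ENNReal.ofReal (D ^ n) * J) := by
        rw [lintegral_const_mul' _ _ ENNReal.ofReal_ne_top,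
          ← lintegral_map hfm (measurable_const_smul D⁻¹),
          Measure.map_addHaar_smul _ (inv_ne_zero hD.ne'), lintegral_smul_measure,
          finrank_euclideanSpace_fin, inv_pow, inv_inv, abs_of_pos (pow_pos hD n), smul_eq_mul]
    _ = ENNReal.ofReal (J.toReal * D ^ (-ε)) := by
        rw [← ENNReal.ofReal_toReal hJ.ne, ← ENNReal.ofReal_mul (by positivity),
          ← ENNReal.ofReal_mul (by positivity), ENNReal.toReal_ofReal ENNReal.toReal_nonneg,
          ← mul_assoc, ← Real.rpow_natCast, ← Real.rpow_add hD, mul_comm]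
        ring_nf
    _ ≤ _ := by
        gcongr
        linarith

/-- Integration over all `x ∈ G` of local weighted energies over balls `B(x, C dist(x,∂G))`. -/
theorem exists_lintegral_local_energy_le {n : ℕ} {c ε : ℝ} (hc : 0 < c) (hε : 0 < ε)
    {G : Set (Euc n)} (hG : IsOpen G) (hG' : G ≠ univ) :
    ∃ C : ℝ, 0 < C ∧ ∀ g : Euc n → ℝ≥0∞, Measurable g →
      ∫⁻ x in G, ENNReal.ofReal (infDist x (frontier G) ^ (-((n : ℝ) + ε))) *
        ∫⁻ y in ball x (c * infDist x (frontier G)) ∩ G,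
          ENNReal.ofReal (infDist y (frontier G) ^ ε) * g y ≤
      ENNReal.ofReal C * ∫⁻ y in G, g y := by
  obtain ⟨J, hJ, hJD⟩ := exists_lintegral_add_dist_rpow_le n hε
  refine ⟨(2 * c + 1) ^ ((n : ℝ) + ε) * J, by positivity, fun g hg => ?_⟩
  let T : Set (Euc n × Euc n) := {q | dist q.2 q.1 < c * infDist q.1 (frontier G)}
  let F : Euc n × Euc n → ℝ≥0∞ := T.indicator fun q =>
    ENNReal.ofReal (infDist q.1 (frontier G) ^ (-((n : ℝ) + ε))) *
      (ENNReal.ofReal (infDist q.2 (frontier G) ^ ε) * g q.2)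
  have hdm : Measurable fun x : Euc n => infDist x (frontier G) :=
    (continuous_infDist_pt _).measurable
  have hF : Measurable F := by
    refine Measurable.indicator ?_ (measurableSet_lt (by fun_prop) (by fun_prop))
    fun_prop
  have hinner : ∀ y ∈ G, ∫⁻ x in G, F (x, y) ≤
      ENNReal.ofReal ((2 * c + 1) ^ ((n : ℝ) + ε) * J) * g y := by
    intro y hy
    have hD := infDist_frontier_pos hG hG' hy
    set D := infDist y (frontier G)
    calc ∫⁻ x in G, F (x, y)
        ≤ ∫⁻ x in G, ENNReal.ofReal (D ^ ε) * g y * ENNReal.ofReal ((2 * c + 1) ^ ((n : ℝ) + ε)) *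
            ENNReal.ofReal ((D + dist y x) ^ (-((n : ℝ) + ε))) := by
          refine setLIntegral_mono_ae' hG.measurableSet (Filter.Eventually.of_forall fun x hx => ?_)
          have hd := infDist_frontier_pos hG hG' hx
          by_cases hT : (x, y) ∈ T
          · simp only [F, indicator_of_mem hT]
            rw [mul_comm, mul_assoc _ (ENNReal.ofReal ((2 * c + 1) ^ ((n : ℝ) + ε))),
              ← ENNReal.ofReal_mul (by positivity)]
            gcongr
            have h1 : dist y x < c * infDist x (frontier G) := hT
            have h2 := infDist_le_infDist_add_dist (s := frontier G) (x := y) (y := x)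
            have h3 : D + dist y x ≤ (2 * c + 1) * infDist x (frontier G) := by linarith
            have h4 : (D + dist y x) / (2 * c + 1) ≤ infDist x (frontier G) := by
              rw [div_le_iff₀ (by positivity)]
              linarith
            have h5 : (0 : ℝ) ≤ (n : ℝ) + ε := by positivity
            calc _ ≤ ((D + dist y x) / (2 * c + 1)) ^ (-((n : ℝ) + ε)) :=
                  Real.rpow_le_rpow_of_nonpos (by positivity) h4 (by linarith)
              _ = _ := by
                  rw [Real.div_rpow (by positivity) (by positivity),
                    Real.rpow_neg (by positivity : 0 ≤ 2 * c + 1), div_inv_eq_mul, mul_comm]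
          · simp only [F, indicator_of_notMem hT]
            exact zero_le
      _ ≤ ∫⁻ x, ENNReal.ofReal (D ^ ε) * g y * ENNReal.ofReal ((2 * c + 1) ^ ((n : ℝ) + ε)) *
            ENNReal.ofReal ((D + dist y x) ^ (-((n : ℝ) + ε))) := setLIntegral_le_lintegral _ _
      _ = ENNReal.ofReal (D ^ ε) * g y * ENNReal.ofReal ((2 * c + 1) ^ ((n : ℝ) + ε)) *
            ∫⁻ x, ENNReal.ofReal ((D + dist y x) ^ (-((n : ℝ) + ε))) :=
          lintegral_const_mul _ (by fun_prop)
      _ ≤ ENNReal.ofReal (D ^ ε) * g y * ENNReal.ofReal ((2 * c + 1) ^ ((n : ℝ) + ε)) *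
            ENNReal.ofReal (J * D ^ (-ε)) := by
          gcongr
          exact hJD y D hD
      _ = ENNReal.ofReal (D ^ ε * (2 * c + 1) ^ ((n : ℝ) + ε) * (J * D ^ (-ε))) * g y := by
          rw [ENNReal.ofReal_mul (p := D ^ ε * (2 * c + 1) ^ ((n : ℝ) + ε)) (by positivity),
            ENNReal.ofReal_mul (p := D ^ ε) (by positivity)]
          ring
      _ = _ := by
          congr 2
          rw [Real.rpow_neg hD.le]
          have : 0 < D ^ ε := by positivity
          field_simp
  calc _ = ∫⁻ x in G, ∫⁻ y in G, F (x, y) := by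
        refine lintegral_congr fun x => ?_
        rw [← setLIntegral_indicator measurableSet_ball,
          ← lintegral_const_mul' _ _ ENNReal.ofReal_ne_top]
        refine lintegral_congr fun y => ?_
        by_cases hT : (x, y) ∈ T
        · have : y ∈ ball x (c * infDist x (frontier G)) := hT
          simp only [F, indicator_of_mem hT, indicator_of_mem this]
        · have : y ∉ ball x (c * infDist x (frontier G)) := hT
          simp only [F, indicator_of_notMem hT, indicator_of_notMem this, mul_zero]
    _ = ∫⁻ y in G, ∫⁻ x in G, F (x, y) := lintegral_lintegral_swap hF.aemeasurable
    _ ≤ ∫⁻ y in G, ENNReal.ofReal ((2 * c + 1) ^ ((n : ℝ) + ε) * J) * g y :=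
        setLIntegral_mono_ae' hG.measurableSet (Filter.Eventually.of_forall hinner)
    _ = _ := lintegral_const_mul' _ _ ENNReal.ofReal_ne_top

theorem ofReal_abs_sub_average_rpow_div_le {n : ℕ} {s p : ℝ} (hs : 0 < s) (hp : 1 ≤ p)
    {G : Set (Euc n)} {u : Euc n → ℝ} (hu : Continuous u) {x : Euc n} {d : ℝ} (hd : 0 < d)
    (hG : ball x (d / 4) ⊆ G) :
    ENNReal.ofReal (|u x - ⨍ w in ball x (d / 4), u w| ^ p / d ^ (s * p)) ≤
      ENNReal.ofReal (1 / (4 ^ (s * p) * volume.real (ball (0 : Euc n) 1))) *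
        gagliardoDensity n s p G u x := by
  have hV := volume_real_unit_ball_pos n
  set V := volume.real (ball (0 : Euc n) 1)
  set X := |u x - ⨍ w in ball x (d / 4), u w| ^ p
  have h := ofReal_abs_sub_average_rpow_mul_le_gagliardoDensity (s := s) hs hp hu
    (by positivity : 0 < d / 4) hG (z := x) (R := d / 4) fun w hw => by
      rw [dist_comm]; exact (mem_ball.1 hw).le
  rw [volume_ball_eq _ (by positivity), ← ENNReal.ofReal_mul (by positivity)] at h
  have hid : (d / 4) ^ ((n : ℝ) + s * p) = (d / 4) ^ n * (d ^ (s * p) / 4 ^ (s * p)) := by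
    rw [Real.rpow_add (by positivity), Real.rpow_natCast, Real.div_rpow hd.le (by norm_num)]
  have hk : 0 < 1 / ((d / 4) ^ n * V * d ^ (s * p)) := by positivity
  calc ENNReal.ofReal (X / d ^ (s * p))
      = ENNReal.ofReal (1 / ((d / 4) ^ n * V * d ^ (s * p))) *
        ENNReal.ofReal (X * ((d / 4) ^ n * V)) := by
        rw [← ENNReal.ofReal_mul hk.le]
        congr 1
        field_simp
    _ ≤ ENNReal.ofReal (1 / ((d / 4) ^ n * V * d ^ (s * p))) *
        (ENNReal.ofReal ((d / 4) ^ ((n : ℝ) + s * p)) * gagliardoDensity n s p G u x) := by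
        gcongr
    _ = _ := by
        rw [← mul_assoc, ← ENNReal.ofReal_mul hk.le, hid]
        congr 2
        field_simp

theorem abs_rpow_le_two_rpow_mul {p : ℝ} (hp : 0 ≤ p) (a b : ℝ) :
    |a| ^ p ≤ 2 ^ p * (|a - b| ^ p + |b| ^ p) := by
  have h1 : |a| ≤ 2 * max |a - b| |b| := by
    have := abs_sub_abs_le_abs_sub a b
    linarith [le_max_left |a - b| |b|, le_max_right |a - b| |b|]
  have h2 : (max |a - b| |b|) ^ p ≤ |a - b| ^ p + |b| ^ p := by
    rcases max_choice |a - b| |b| with h | h <;> rw [h]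
    · exact le_add_of_nonneg_right (by positivity)
    · exact le_add_of_nonneg_left (by positivity)
  calc |a| ^ p ≤ (2 * max |a - b| |b|) ^ p := by gcongr
    _ = 2 ^ p * (max |a - b| |b|) ^ p := Real.mul_rpow (by norm_num) (by positivity)
    _ ≤ _ := by gcongr

/-- If `0<s<1`, `1<p<∞`, `0<sp<n`, `G ⊊ ℝⁿ` is open, and there are
`n-sp < λ ≤ n`, `C₀ > 0`, `c ≥ 1` with `H^λ_∞(∂^vis_{x,c} G) ≥ C₀ dist(x,∂G)^λ`
for all `x ∈ G`, then `G` admits the `(s,p)`-Hardy inequality. -/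
theorem statement0 (n : ℕ) (s p : ℝ) (hs0 : 0 < s) (hs1 : s < 1) (hp1 : 1 < p)
    (hsp0 : 0 < s * p) (hspn : s * p < n)
    (G : Set (Euc n)) (hGopen : IsOpen G) (hGproper : G ≠ Set.univ)
    (lam C₀ c : ℝ) (hlam1 : (n : ℝ) - s * p < lam) (hlam2 : lam ≤ n)
    (hC₀ : 0 < C₀) (hc : 1 ≤ c)
    (hvis : ∀ x ∈ G, ENNReal.ofReal (C₀ * Metric.infDist x (frontier G) ^ lam) ≤
      hContent n lam (visualBoundary n c G x)) :
    AdmitsHardy n s p G := by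
  obtain ⟨ε, hε⟩ : ∃ ε, ε = (lam - ((n : ℝ) - s * p)) / 2 := ⟨_, rfl⟩
  have hε0 : 0 < ε := by rw [hε]; linarith
  obtain rfl : lam = (n : ℝ) - s * p + 2 * ε := by rw [hε]; ring
  obtain ⟨C₁, hC₁, havg⟩ := ofReal_average_rpow_div_le hs0 hp1 hc hε0 (by linarith) hC₀ hGopen
    hGproper hvis
  obtain ⟨C₂, hC₂, hloc⟩ := exists_lintegral_local_energy_le (c := c + 1) (by linarith) hε0 hGopen
    hGproper
  have hV := volume_real_unit_ball_pos n
  obtain ⟨C₃, hC₃⟩ : ∃ C₃, C₃ = 1 / (4 ^ (s * p) * volume.real (ball (0 : Euc n) 1)) := ⟨_, rfl⟩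
  have hC₃0 : 0 < C₃ := by rw [hC₃]; positivity
  refine ⟨2 ^ p * (C₃ + C₁ * C₂), by positivity, fun u hu _ hsupp => ?_⟩
  have hu' := hu.continuous
  have hgm : Measurable (gagliardoDensity n s p G u) := measurable_gagliardoDensity hu'
  change _ ≤ _ * ∫⁻ x in G, gagliardoDensity n s p G u x
  set E := fun x => ENNReal.ofReal (infDist x (frontier G) ^ (-((n : ℝ) + ε))) *
        ∫⁻ y in ball x ((c + 1) * infDist x (frontier G)) ∩ G,
          ENNReal.ofReal (infDist y (frontier G) ^ ε) * gagliardoDensity n s p G u y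
  calc ∫⁻ x in G, ENNReal.ofReal (|u x| ^ p / infDist x (frontier G) ^ (s * p))
      ≤ ∫⁻ x in G, ENNReal.ofReal (2 ^ p) * (ENNReal.ofReal C₃ * gagliardoDensity n s p G u x +
          ENNReal.ofReal C₁ * E x) := by
        refine setLIntegral_mono_ae' hGopen.measurableSet
          (Filter.Eventually.of_forall fun x hx => ?_)
        have hd := infDist_frontier_pos hGopen hGproper hx
        have hball : ball x (infDist x (frontier G) / 4) ⊆ G := fun w hw => by
          by_contra hwG
          have h1 := infDist_frontier_le_dist hx hwG
          rw [mem_ball, dist_comm] at hw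
          linarith
        have h1 := ofReal_abs_sub_average_rpow_div_le hs0 hp1.le hu' hd hball
        rw [← hC₃] at h1
        refine le_trans ?_ (mul_le_mul_right (add_le_add h1 (havg u hu' hsupp x hx)) _)
        rw [← ENNReal.ofReal_add (by positivity) (by positivity),
          ← ENNReal.ofReal_mul (by positivity), ← add_div, ← mul_div_assoc]
        gcongr
        exact abs_rpow_le_two_rpow_mul (by linarith) _ _
    _ = ENNReal.ofReal (2 ^ p) * (ENNReal.ofReal C₃ * (∫⁻ x in G, gagliardoDensity n s p G u x) +
          ENNReal.ofReal C₁ * ∫⁻ x in G, E x) := by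
        rw [lintegral_const_mul' _ _ ENNReal.ofReal_ne_top, lintegral_add_left (by fun_prop),
          lintegral_const_mul' _ _ ENNReal.ofReal_ne_top,
          lintegral_const_mul' _ _ ENNReal.ofReal_ne_top]
    _ ≤ ENNReal.ofReal (2 ^ p) * (ENNReal.ofReal C₃ * (∫⁻ x in G, gagliardoDensity n s p G u x) +
          ENNReal.ofReal C₁ * (ENNReal.ofReal C₂ * ∫⁻ x in G, gagliardoDensity n s p G u x)) := by
        gcongr
        exact hloc _ hgm
    _ = _ := by
        rw [ENNReal.ofReal_mul (by positivity), ENNReal.ofReal_add (by positivity) (by positivity),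
          ENNReal.ofReal_mul (by positivity)]
        ring

end
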